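/- arXiv:math/9912217 — 2 statements merged into one kernel-verified Lean document; each statement's English description precedes it below -/
import Mathlib

section
/- Let M be an open subset of ℝⁿ, let k ≤ n, and let F = (F₁,…,F_k) : M → ℝᵏ be a smooth map. Denote by S_F = {m ∈ M : F(m) = 0} its zero set and assume that the derivative DF(m) : ℝⁿ → ℝᵏ is surjective (has rank k) for every m ∈ S_F. Let η₀ > 0 and let f : (−η₀,η₀) × M → ℝ be smooth with f(η,m) = 0 for all η ∈ (−η₀,η₀) and all m ∈ S_F. Then there exist smooth functions Q₁,…,Q_k : (−η₀,η₀) × M → ℝ such that f(η,m) = Q₁(η,m)F₁(m) + … + Q_k(η,m)F_k(m) for all (η,m) ∈ (−η₀,η₀) × M. -/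
open Set Topology

open scoped ContDiff Manifold

section Auxiliary

universe u

/-- Differentiation under the integral sign for a `C¹` integrand on a compact interval. -/
theorem hasFDerivAt_intervalIntegral_of_contDiff {E G : Type*}
    [NormedAddCommGroup E] [NormedSpace ℝ E] [ProperSpace E]
    [NormedAddCommGroup G] [NormedSpace ℝ G]
    {g : E × ℝ → G} (hg : ContDiff ℝ 1 g) (a b : ℝ) (x : E) :
    HasFDerivAt (fun y ↦ ∫ t in a..b, g (y, t))
      (∫ t in a..b, (fderiv ℝ g (x, t)).comp (ContinuousLinearMap.inl ℝ E ℝ)) x := by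
  have hg' : Continuous fun z : E × ℝ ↦
      (fderiv ℝ g z).comp (ContinuousLinearMap.inl ℝ E ℝ) :=
    (hg.continuous_fderiv one_ne_zero).clm_comp continuous_const
  obtain ⟨C, hC⟩ := ((isCompact_closedBall x 1).prod
    (isCompact_uIcc (a := a) (b := b))).exists_bound_of_continuousOn hg'.continuousOn
  refine intervalIntegral.hasFDerivAt_integral_of_dominated_of_fderiv_le
    (F := fun y t ↦ g (y, t))
    (F' := fun y t ↦ (fderiv ℝ g (y, t)).comp (ContinuousLinearMap.inl ℝ E ℝ))
    (bound := fun _ ↦ C) (Metric.closedBall_mem_nhds x one_pos) ?_ ?_ ?_ ?_ ?_ ?_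
  · exact .of_forall fun y ↦
      (hg.continuous.comp (Continuous.prodMk_right y)).aestronglyMeasurable
  · exact (hg.continuous.comp (Continuous.prodMk_right x)).intervalIntegrable a b
  · exact (hg'.comp (Continuous.prodMk_right x)).aestronglyMeasurable
  · exact .of_forall fun t ht y hy ↦ hC (y, t) ⟨hy, uIoc_subset_uIcc ht⟩
  · exact intervalIntegrable_const
  · refine .of_forall fun t _ y _ ↦ ?_
    exact ((hg.differentiable one_ne_zero) (y, t)).hasFDerivAt.comp y
      (hasFDerivAt_prodMk_left y t)

/-- An interval integral depends smoothly on parameters if its integrand is smooth. -/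
theorem contDiff_intervalIntegral_of_contDiff {E G : Type u}
    [NormedAddCommGroup E] [NormedSpace ℝ E] [ProperSpace E]
    [NormedAddCommGroup G] [NormedSpace ℝ G]
    {g : E × ℝ → G} (hg : ContDiff ℝ ∞ g) (a b : ℝ) :
    ContDiff ℝ ∞ fun y ↦ ∫ t in a..b, g (y, t) := by
  rw [contDiff_infty]
  intro n
  induction n generalizing G with
  | zero =>
    refine contDiff_zero.2 (continuous_iff_continuousAt.2 fun x ↦ ?_)
    exact (hasFDerivAt_intervalIntegral_of_contDiff
      (hg.of_le (by exact_mod_cast le_top)) a b x).continuousAt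
  | succ n ih =>
    have hderiv := hasFDerivAt_intervalIntegral_of_contDiff
      (hg.of_le (by exact_mod_cast le_top)) a b
    have hsucc : ((n + 1 : ℕ) : WithTop ℕ∞) = n + 1 := by norm_cast
    rw [hsucc, contDiff_succ_iff_hasFDerivAt]
    refine ⟨_, ?_, hderiv⟩
    exact ih ((hg.fderiv_right (m := ∞) le_rfl).clm_comp contDiff_const)

/-- **Hadamard's lemma** for a linear submersion: a smooth function vanishing on the kernel of a
continuous linear map `A` with a right inverse factors smoothly through `A`. -/
theorem exists_contDiff_eq_apply_of_eq_zero_on_ker {E W : Type u}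
    [NormedAddCommGroup E] [NormedSpace ℝ E] [ProperSpace E]
    [NormedAddCommGroup W] [NormedSpace ℝ W]
    (A : E →L[ℝ] W) (R : W →L[ℝ] E) (hAR : ∀ w, A (R w) = w)
    {h : E → ℝ} (hh : ContDiff ℝ ∞ h) (hker : ∀ y, A y = 0 → h y = 0) :
    ∃ q : E → W →L[ℝ] ℝ, ContDiff ℝ ∞ q ∧ ∀ y, h y = q y (A y) := by
  let γ : E × ℝ → E := fun z ↦ z.1 - (1 - z.2) • R (A z.1)
  have hγ : ContDiff ℝ ∞ γ := by fun_prop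
  have hg : ContDiff ℝ ∞ fun z : E × ℝ ↦ (fderiv ℝ h (γ z)).comp R :=
    ((hh.fderiv_right (m := ∞) le_rfl).comp hγ).clm_comp contDiff_const
  refine ⟨_, contDiff_intervalIntegral_of_contDiff hg 0 1, fun y ↦ ?_⟩
  have hcont : Continuous fun t : ℝ ↦ (fderiv ℝ h (γ (y, t))).comp R :=
    hg.continuous.comp (Continuous.prodMk_right y)
  rw [ContinuousLinearMap.intervalIntegral_apply (hcont.intervalIntegrable 0 1)]
  have hderiv : ∀ t ∈ uIcc (0 : ℝ) 1, HasDerivAt (fun t ↦ h (γ (y, t)))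
      (((fderiv ℝ h (γ (y, t))).comp R) (A y)) t := by
    intro t _
    have hγt : HasDerivAt (fun t ↦ γ (y, t)) (R (A y)) t := by
      simpa [γ] using
        (((hasDerivAt_id t).const_sub 1).smul_const (R (A y))).const_sub y
    exact ((hh.differentiable (by simp)) (γ (y, t))).hasFDerivAt.comp_hasDerivAt t hγt
  rw [intervalIntegral.integral_eq_sub_of_hasDerivAt hderiv
    ((hcont.clm_apply continuous_const).intervalIntegrable 0 1)]
  have h0 : h (γ (y, 0)) = 0 := hker _ (by simp [γ, hAR])
  have h1 : γ (y, 1) = y := by simp [γ]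
  rw [h0, h1, sub_zero]

/-- Local smooth factorization of `f` through `G` near a zero of `G` at which `G` is a
submersion. -/
theorem exists_contDiffOn_eq_apply_near_zero {E W : Type u}
    [NormedAddCommGroup E] [NormedSpace ℝ E] [FiniteDimensional ℝ E]
    [NormedAddCommGroup W] [NormedSpace ℝ W] [FiniteDimensional ℝ W]
    {U : Set E} (hU : IsOpen U) {G : E → W} (hG : ContDiffOn ℝ ∞ G U)
    {f : E → ℝ} (hf : ContDiffOn ℝ ∞ f U) (hvanish : ∀ x ∈ U, G x = 0 → f x = 0)
    {p : E} (hp : p ∈ U) (hsurj : Function.Surjective (fderiv ℝ G p)) :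
    ∃ V ∈ 𝓝 p, ∃ q : E → W →L[ℝ] ℝ, ContDiffOn ℝ ∞ q V ∧ ∀ x ∈ V, f x = q x (G x) := by
  have : ProperSpace E := FiniteDimensional.proper ℝ E
  have : CompleteSpace E := FiniteDimensional.complete ℝ E
  set A : E →L[ℝ] W := fderiv ℝ G p with hA
  obtain ⟨R', hR'⟩ := (A : E →ₗ[ℝ] W).exists_rightInverse_of_surjective
    (LinearMap.range_eq_top.2 hsurj)
  let R : W →L[ℝ] E := LinearMap.toContinuousLinearMap R'
  have hAR : ∀ w, A (R w) = w := fun w ↦ LinearMap.congr_fun hR' w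
  let Φ : E → E := fun x ↦ x + R (G x - A x)
  have hAΦ : ∀ x, A (Φ x) = G x := fun x ↦ by simp [Φ, hAR]
  have hΦ : ∀ x ∈ U, ContDiffAt ℝ ∞ Φ x := fun x hx ↦
    contDiffAt_id.add (R.contDiff.contDiffAt.comp x
      ((hG.contDiffAt (hU.mem_nhds hx)).sub A.contDiff.contDiffAt))
  have hΦ' : HasFDerivAt Φ ((ContinuousLinearEquiv.refl ℝ E : E ≃L[ℝ] E) : E →L[ℝ] E) p := by
    have hGp : HasFDerivAt G A p :=
      ((hG.contDiffAt (hU.mem_nhds hp)).differentiableAt (by simp)).hasFDerivAt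
    have := (hasFDerivAt_id p).fun_add
      (R.hasFDerivAt.comp p (hGp.fun_sub A.hasFDerivAt))
    rwa [sub_self, ContinuousLinearMap.comp_zero, add_zero] at this
  let e := (hΦ p hp).toOpenPartialHomeomorph Φ hΦ' (by simp)
  have hps : p ∈ e.source := (hΦ p hp).mem_toOpenPartialHomeomorph_source hΦ' (by simp)
  have heΦ : ∀ x, e x = Φ x := fun _ ↦ rfl
  have hpt : Φ p ∈ e.target := e.map_source hps
  have hep : e.symm (Φ p) = p := e.left_inv hps
  have hsymm : Filter.Tendsto e.symm (𝓝 (Φ p)) (𝓝 p) := by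
    have := (e.continuousAt_symm hpt).tendsto
    rwa [hep] at this
  have hequiv : ∀ᶠ x in 𝓝 p, fderiv ℝ Φ x ∈
      range ((↑) : (E ≃L[ℝ] E) → (E →L[ℝ] E)) := by
    have hc : ContinuousAt (fderiv ℝ Φ) p :=
      ((hΦ p hp).fderiv_right (m := 0) (by simp)).continuousAt
    refine hc.eventually_mem ?_
    rw [hΦ'.fderiv]
    exact ContinuousLinearEquiv.nhds _
  have hS : ∀ᶠ y in 𝓝 (Φ p), y ∈ e.target ∧ e.symm y ∈ U ∧
      ContDiffAt ℝ ∞ (fun y ↦ f (e.symm y)) y := by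
    filter_upwards [e.open_target.mem_nhds hpt, hsymm.eventually (hU.mem_nhds hp),
      hsymm.eventually hequiv] with y hy hyU ⟨L, hL⟩
    refine ⟨hy, hyU, ?_⟩
    have hd : HasFDerivAt e (L : E →L[ℝ] E) (e.symm y) := by
      rw [hL]
      exact ((hΦ _ hyU).differentiableAt (by simp)).hasFDerivAt
    exact (hf.contDiffAt (hU.mem_nhds hyU)).comp y
      (e.contDiffAt_symm hy hd (hΦ _ hyU))
  obtain ⟨r, hr, hrS⟩ := Metric.nhds_basis_closedBall.mem_iff.1 hS
  let χ : ContDiffBump (Φ p) := ⟨r / 2, r, half_pos hr, half_lt_self hr⟩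
  have hχS : tsupport χ ⊆ _ := χ.tsupport_eq.trans_subset hrS
  have hh : ContDiff ℝ ∞ fun y ↦ χ y * f (e.symm y) := by
    refine contDiff_iff_contDiffAt.2 fun y ↦ ?_
    by_cases hy : y ∈ tsupport χ
    · exact χ.contDiff.contDiffAt.mul (hχS hy).2.2
    · refine contDiffAt_const (c := (0 : ℝ)) |>.congr_of_eventuallyEq ?_
      filter_upwards [notMem_tsupport_iff_eventuallyEq.1 hy] with z hz
      simp [hz]
  obtain ⟨q, hq, hqeq⟩ := exists_contDiff_eq_apply_of_eq_zero_on_ker A R hAR hh (by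
    intro y hy
    by_cases hyχ : y ∈ tsupport χ
    · obtain ⟨hyt, hyU, -⟩ := hχS hyχ
      have : G (e.symm y) = 0 := by
        rw [← hAΦ, ← heΦ, e.right_inv hyt, hy]
      rw [hvanish _ hyU this, mul_zero]
    · rw [image_eq_zero_of_notMem_tsupport hyχ, zero_mul])
  have hev : ∀ᶠ x in 𝓝 p, x ∈ U ∧ x ∈ e.source ∧ χ (Φ x) = 1 :=
    (hU.eventually_mem hp).and ((e.open_source.eventually_mem hps).and
      ((hΦ p hp).continuousAt.eventually χ.eventuallyEq_one))
  refine ⟨_, hev, fun x ↦ q (Φ x), fun x hx ↦ ?_, fun x hx ↦ ?_⟩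
  · exact (hq.contDiffAt.comp x (hΦ x hx.1)).contDiffWithinAt
  · have := hqeq (Φ x)
    rwa [hx.2.2, one_mul, hAΦ, ← heΦ, e.left_inv hx.2.1] at this

/-- Local smooth factorization of `f` through `G` near a point where `G` does not vanish. -/
theorem exists_contDiffOn_eq_apply_near_ne_zero {E W : Type*}
    [NormedAddCommGroup E] [NormedSpace ℝ E] [NormedAddCommGroup W] [NormedSpace ℝ W]
    {U : Set E} (hU : IsOpen U) {G : E → W} (hG : ContDiffOn ℝ ∞ G U)
    {f : E → ℝ} (hf : ContDiffOn ℝ ∞ f U) {p : E} (hp : p ∈ U) (hGp : G p ≠ 0) :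
    ∃ V ∈ 𝓝 p, ∃ q : E → W →L[ℝ] ℝ, ContDiffOn ℝ ∞ q V ∧ ∀ x ∈ V, f x = q x (G x) := by
  obtain ⟨l, hl⟩ : ∃ l : W →L[ℝ] ℝ, l (G p) ≠ 0 := by
    obtain ⟨l, -, hl⟩ := exists_dual_vector ℝ (G p) (norm_ne_zero_iff.2 hGp)
    exact ⟨l, by rw [hl]; simpa using hGp⟩
  have hev : ∀ᶠ x in 𝓝 p, x ∈ U ∧ l (G x) ≠ 0 :=
    (hU.eventually_mem hp).and ((l.continuous.continuousAt.comp
      (hG.continuousOn.continuousAt (hU.mem_nhds hp))).eventually_ne hl)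
  refine ⟨_, hev, fun x ↦ (f x / l (G x)) • l, ?_, fun x hx ↦ ?_⟩
  · have hsub : {x | x ∈ U ∧ l (G x) ≠ 0} ⊆ U := fun x hx ↦ hx.1
    exact ((hf.mono hsub).div (l.contDiff.comp_contDiffOn (hG.mono hsub))
      fun x hx ↦ hx.2).smul contDiffOn_const
  · simp [div_mul_cancel₀ _ hx.2]

/-- A smooth function on an open set which vanishes on the zero set of a smooth map `G` of
maximal rank along its zeros factors smoothly through `G`. -/
theorem exists_contDiffOn_eq_apply {E W : Type u}
    [NormedAddCommGroup E] [NormedSpace ℝ E] [FiniteDimensional ℝ E]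
    [NormedAddCommGroup W] [NormedSpace ℝ W] [FiniteDimensional ℝ W]
    {U : Set E} (hU : IsOpen U) {G : E → W} (hG : ContDiffOn ℝ ∞ G U)
    (hsurj : ∀ x ∈ U, G x = 0 → Function.Surjective (fderiv ℝ G x))
    {f : E → ℝ} (hf : ContDiffOn ℝ ∞ f U) (hvanish : ∀ x ∈ U, G x = 0 → f x = 0) :
    ∃ q : E → W →L[ℝ] ℝ, ContDiffOn ℝ ∞ q U ∧ ∀ x ∈ U, f x = q x (G x) := by
  classical
  have : ProperSpace E := FiniteDimensional.proper ℝ E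
  let O : TopologicalSpace.Opens E := ⟨U, hU⟩
  have : LocallyCompactSpace O := hU.locallyCompactSpace
  obtain ⟨g, hg⟩ := exists_contMDiffMap_forall_mem_convex_of_local (n := ⊤) (M := O)
    𝓘(ℝ, E) (F := W →L[ℝ] ℝ) (t := fun x : O ↦ {l | f x = l (G x)})
    (by
      intro x l₁ h₁ l₂ h₂ a b _ _ hab
      simp only [mem_ofPred_eq] at h₁ h₂
      simp only [mem_ofPred_eq, add_apply, smul_apply, ← h₁, ← h₂, ← add_smul,
        hab, one_smul])
    (by
      rintro ⟨x, hx⟩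
      obtain ⟨V, hV, q, hq, hqV⟩ : ∃ V ∈ 𝓝 x, ∃ q : E → W →L[ℝ] ℝ,
          ContDiffOn ℝ ∞ q V ∧ ∀ y ∈ V, f y = q y (G y) := by
        by_cases hGx : G x = 0
        · exact exists_contDiffOn_eq_apply_near_zero hU hG hf hvanish hx (hsurj x hx hGx)
        · exact exists_contDiffOn_eq_apply_near_ne_zero hU hG hf hx hGx
      refine ⟨Subtype.val ⁻¹' V, continuous_subtype_val.continuousAt hV,
        fun y ↦ q y, ?_, fun y hy ↦ hqV y hy⟩
      exact hq.contMDiffOn.comp contMDiff_subtype_val.contMDiffOn fun y hy ↦ hy)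
  let q : E → W →L[ℝ] ℝ := fun x ↦ if hx : x ∈ U then g ⟨x, hx⟩ else 0
  have hqg : ∀ x : O, q x = g x := fun x ↦ dif_pos x.2
  refine ⟨q, fun x hx ↦ ?_, fun x hx ↦ (hg ⟨x, hx⟩).trans (by rw [← hqg ⟨x, hx⟩])⟩
  have hgx : ContMDiffAt 𝓘(ℝ, E) 𝓘(ℝ, W →L[ℝ] ℝ) ∞ (fun y : O ↦ q y) ⟨x, hx⟩ := by
    simp only [hqg]
    exact g.contMDiff ⟨x, hx⟩
  exact (contMDiffAt_subtype_iff.1 hgx).contDiffAt.contDiffWithinAt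

end Auxiliary

/-- **Parametrized Hadamard factorization.** If `F : M → ℝᵏ` is smooth on an open set
`M ⊆ ℝⁿ`, of maximal rank (surjective derivative) on its zero set, and
`f : (-η₀, η₀) × M → ℝ` is smooth and vanishes on the zero set of `F` identically in the
parameter, then `f` factors smoothly through the components of `F`. -/
theorem smooth_factorization_through_zero_set {n k : ℕ} (hkn : k ≤ n)
    (M : Set (EuclideanSpace ℝ (Fin n))) (hM : IsOpen M)
    (F : EuclideanSpace ℝ (Fin n) → EuclideanSpace ℝ (Fin k))
    (hF : ContDiffOn ℝ (⊤ : ℕ∞) F M)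
    (hrank : ∀ m ∈ M, F m = 0 → Function.Surjective (fderiv ℝ F m))
    (η₀ : ℝ) (hη₀ : 0 < η₀)
    (f : ℝ × EuclideanSpace ℝ (Fin n) → ℝ)
    (hf : ContDiffOn ℝ (⊤ : ℕ∞) f (Ioo (-η₀) η₀ ×ˢ M))
    (hvanish : ∀ η ∈ Ioo (-η₀) η₀, ∀ m ∈ M, F m = 0 → f (η, m) = 0) :
    ∃ Q : Fin k → ℝ × EuclideanSpace ℝ (Fin n) → ℝ,
      (∀ i, ContDiffOn ℝ (⊤ : ℕ∞) (Q i) (Ioo (-η₀) η₀ ×ˢ M)) ∧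
      ∀ η ∈ Ioo (-η₀) η₀, ∀ m ∈ M, f (η, m) = ∑ i, Q i (η, m) * F m i := by
  have hU : IsOpen (Ioo (-η₀) η₀ ×ˢ M) := isOpen_Ioo.prod hM
  have hG : ContDiffOn ℝ ∞ (fun z : ℝ × EuclideanSpace ℝ (Fin n) ↦ F z.2)
      (Ioo (-η₀) η₀ ×ˢ M) :=
    hF.comp contDiffOn_snd fun z hz ↦ hz.2
  obtain ⟨q, hq, hqf⟩ := exists_contDiffOn_eq_apply hU hG
    (by
      rintro ⟨η, m⟩ hz hFm
      have hd : HasFDerivAt F (fderiv ℝ F m) m :=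
        ((hF.contDiffAt (hM.mem_nhds hz.2)).differentiableAt (by simp)).hasFDerivAt
      have hcomp : HasFDerivAt (fun z : ℝ × EuclideanSpace ℝ (Fin n) ↦ F z.2)
          ((fderiv ℝ F m).comp (ContinuousLinearMap.snd ℝ ℝ (EuclideanSpace ℝ (Fin n))))
          (η, m) :=
        HasFDerivAt.comp (η, m) hd hasFDerivAt_snd
      rw [hcomp.fderiv]
      exact (hrank m hz.2 hFm).comp Prod.snd_surjective)
    hf (fun z hz hFz ↦ hvanish z.1 hz.1 z.2 hz.2 hFz)
  refine ⟨fun i z ↦ q z (EuclideanSpace.single i 1),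
    fun i ↦ hq.clm_apply contDiffOn_const, fun η hη m hm ↦ ?_⟩
  rw [hqf (η, m) ⟨hη, hm⟩]
  conv_lhs => rw [← (EuclideanSpace.basisFun (Fin k) ℝ).sum_repr (F m)]
  simp [map_sum, mul_comm]
end

section
/- Let ρ be a Schwartz function on ℝⁿ with ∫ρ(x)dx = 1 and ∫x^α ρ(x)dx = 0 for every multi-index α with |α| ≥ 1, and set ρ_ε(x) = ε^{−n}ρ(x/ε) for ε ∈ (0,1]. Let f ∈ C^∞(ℝⁿ) be such that every derivative of f is polynomially bounded, i.e. for each multi-index α there exist C > 0 and p ∈ ℕ with |∂^α f(x)| ≤ C(1+|x|)^p for all x. Then the family (f ∗ ρ_ε − f)_{ε∈(0,1]} is negligible on ℝⁿ: for every compact K ⊆ ℝⁿ, every multi-index α and every q ∈ ℕ, sup_{x∈K} |∂^α (f ∗ ρ_ε)(x) − ∂^α f(x)| = O(ε^{q}) as ε → 0⁺. -/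
open Topology Filter MeasureTheory

section Mollifier

variable {E V : Type*} [NormedAddCommGroup E] [NormedSpace ℝ E]
  [NormedAddCommGroup V] [NormedSpace ℝ V]

lemma Function.HasTemperateGrowth.fderiv {F : E → V} (hF : F.HasTemperateGrowth) :
    (fderiv ℝ F).HasTemperateGrowth := by
  refine ⟨hF.1.fderiv_right (by simp), fun k => ?_⟩
  obtain ⟨p, C, h⟩ := hF.2 (k + 1)
  exact ⟨p, C, fun x => by simpa only [norm_iteratedFDeriv_fderiv] using h x⟩

lemma Function.HasTemperateGrowth.exists_norm_le {F : E → V} (hF : F.HasTemperateGrowth) :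
    ∃ (p : ℕ) (C : ℝ), 0 ≤ C ∧ ∀ x, ‖F x‖ ≤ C * (1 + ‖x‖) ^ p := by
  obtain ⟨p, C, hC, h⟩ := hF.norm_iteratedFDeriv_le_uniform 0
  exact ⟨p, C, hC, fun x => by simpa using h 0 le_rfl x⟩

lemma one_add_norm_sub_smul_le (x y : E) {ε : ℝ} (h0 : 0 ≤ ε) (h1 : ε ≤ 1) :
    1 + ‖x - ε • y‖ ≤ (1 + ‖x‖) * (1 + ‖y‖) := by
  have h : ‖x - ε • y‖ ≤ ‖x‖ + ε * ‖y‖ := by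
    simpa [norm_smul, abs_of_nonneg h0] using norm_sub_le x (ε • y)
  nlinarith [norm_nonneg x, norm_nonneg y, mul_nonneg (norm_nonneg x) (norm_nonneg y)]

/-- Taylor's theorem with the remainder bounded through a polynomial bound on the last
derivative. -/
lemma norm_sub_taylor_sum_le [CompleteSpace V] {F : E → V} {q p : ℕ} {C : ℝ} (hC : 0 ≤ C)
    (hF : ContDiff ℝ (q + 1) F)
    (hb : ∀ x, ‖iteratedFDeriv ℝ (q + 1) F x‖ ≤ C * (1 + ‖x‖) ^ p) (x y : E) :
    ‖F (x + y) - ∑ k ∈ Finset.range (q + 1),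
        (k.factorial : ℝ)⁻¹ • iteratedFDeriv ℝ k F x (fun _ => y)‖
      ≤ C * (1 + ‖x‖ + ‖y‖) ^ p * ‖y‖ ^ (q + 1) := by
  rw [map_add_eq_sum_add_integral_iteratedFDeriv (n := q) (fun t _ => hF.contDiffAt),
    add_sub_cancel_left, norm_smul]
  have hfac : ‖(q.factorial : ℝ)⁻¹‖ ≤ 1 := by
    rw [norm_inv, Real.norm_natCast]
    exact inv_le_one_of_one_le₀ (by exact_mod_cast q.factorial_pos)
  refine (mul_le_of_le_one_left (norm_nonneg _) hfac).trans ?_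
  refine (intervalIntegral.norm_integral_le_of_norm_le_const
    (C := C * (1 + ‖x‖ + ‖y‖) ^ p * ‖y‖ ^ (q + 1)) fun t ht => ?_).trans (by simp)
  rw [Set.uIoc_of_le zero_le_one] at ht
  have hpow : ‖(1 - t) ^ q‖ ≤ 1 := by
    rw [norm_pow, Real.norm_of_nonneg (by linarith [ht.2])]
    exact pow_le_one₀ (by linarith [ht.2]) (by linarith [ht.1])
  rw [norm_smul]
  refine (mul_le_of_le_one_left (norm_nonneg _) hpow).trans ?_
  refine (ContinuousMultilinearMap.le_opNorm _ _).trans ?_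
  rw [Finset.prod_const, Finset.card_univ, Fintype.card_fin]
  have hxt : ‖x + t • y‖ ≤ ‖x‖ + ‖y‖ := by
    refine (norm_add_le _ _).trans ?_
    rw [norm_smul, Real.norm_of_nonneg ht.1.le]
    gcongr
    exact mul_le_of_le_one_left (norm_nonneg _) ht.2
  gcongr
  refine (hb _).trans ?_
  gcongr C * ?_ ^ p
  linarith

variable [MeasurableSpace E] [BorelSpace E] [SecondCountableTopology E]
  {μ : Measure E} [μ.HasTemperateGrowth]

namespace SchwartzMap

lemma integrable_one_add_norm_pow_mul (ρ : SchwartzMap E ℝ) (m : ℕ) :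
    Integrable (fun y => (1 + ‖y‖) ^ m * ‖ρ y‖) μ := by
  have h : (fun y => (1 + ‖y‖) ^ m * ‖ρ y‖)
      = fun y => ∑ k ∈ Finset.range (m + 1), (m.choose k : ℝ) * (‖y‖ ^ k * ‖ρ y‖) := by
    ext y
    rw [add_comm, add_pow, Finset.sum_mul]
    refine Finset.sum_congr rfl fun k _ => ?_
    simp only [one_pow]
    ring
  rw [h]
  exact integrable_finsetSum _ fun k _ => (ρ.integrable_pow_mul μ k).const_mul _

lemma integrable_smul_of_norm_le (ρ : SchwartzMap E ℝ) {G : E → V} (hG : Continuous G)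
    {C : ℝ} {m : ℕ} (hb : ∀ y, ‖G y‖ ≤ C * (1 + ‖y‖) ^ m) :
    Integrable (fun y => ρ y • G y) μ := by
  refine ((ρ.integrable_one_add_norm_pow_mul m).const_mul C).mono'
    (ρ.continuous.smul hG).aestronglyMeasurable (.of_forall fun y => ?_)
  rw [norm_smul]
  calc ‖ρ y‖ * ‖G y‖ ≤ ‖ρ y‖ * (C * (1 + ‖y‖) ^ m) := by gcongr; exact hb y
    _ = _ := by ring

lemma integrable_smul_comp_sub_smul (ρ : SchwartzMap E ℝ) {F : E → V}
    (hF : F.HasTemperateGrowth) {ε : ℝ} (h0 : 0 ≤ ε) (h1 : ε ≤ 1) (x : E) :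
    Integrable (fun y => ρ y • F (x - ε • y)) μ := by
  obtain ⟨p, C, hC, hb⟩ := hF.exists_norm_le
  refine ρ.integrable_smul_of_norm_le (C := C * (1 + ‖x‖) ^ p) (m := p)
    (hF.1.continuous.comp (by fun_prop)) fun y => (hb _).trans ?_
  rw [mul_assoc, ← mul_pow]
  gcongr
  exact one_add_norm_sub_smul_le x y h0 h1

lemma integrable_smul_multilinear (ρ : SchwartzMap E ℝ) {j : ℕ}
    (M : ContinuousMultilinearMap ℝ (fun _ : Fin j => E) V) :
    Integrable (fun y => ρ y • M fun _ => y) μ := by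
  refine ρ.integrable_smul_of_norm_le (C := ‖M‖) (m := j)
    (M.cont.comp (by fun_prop)) fun y => (M.le_opNorm _).trans ?_
  rw [Finset.prod_const, Finset.card_univ, Fintype.card_fin]
  gcongr
  linarith

/-- Differentiation under the integral sign for a mollified function. -/
lemma hasFDerivAt_integral_smul_comp_sub_smul (ρ : SchwartzMap E ℝ) {F : E → V}
    (hF : F.HasTemperateGrowth) {ε : ℝ} (h0 : 0 ≤ ε) (h1 : ε ≤ 1) (x : E) :
    HasFDerivAt (fun z => ∫ y, ρ y • F (z - ε • y) ∂μ)
      (∫ y, ρ y • fderiv ℝ F (x - ε • y) ∂μ) x := by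
  obtain ⟨p, C, hC, hb⟩ := hF.fderiv.exists_norm_le
  refine hasFDerivAt_integral_of_dominated_of_fderiv_le
    (F := fun z y => ρ y • F (z - ε • y)) (F' := fun z y => ρ y • fderiv ℝ F (z - ε • y))
    (bound := fun y => C * (2 + ‖x‖) ^ p * ((1 + ‖y‖) ^ p * ‖ρ y‖))
    (Metric.ball_mem_nhds x one_pos)
    (.of_forall fun z => (ρ.integrable_smul_comp_sub_smul hF h0 h1 z).aestronglyMeasurable)
    (ρ.integrable_smul_comp_sub_smul hF h0 h1 x)
    (ρ.integrable_smul_comp_sub_smul hF.fderiv h0 h1 x).aestronglyMeasurable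
    (.of_forall fun y z hz => ?_)
    ((ρ.integrable_one_add_norm_pow_mul p).const_mul _)
    (.of_forall fun y z _ => ?_)
  · have hz' : 1 + ‖z‖ ≤ 2 + ‖x‖ := by
      have h := norm_le_norm_add_norm_sub' z x
      rw [mem_ball_iff_norm] at hz
      linarith
    calc ‖ρ y • fderiv ℝ F (z - ε • y)‖
        ≤ ‖ρ y‖ * (C * ((2 + ‖x‖) * (1 + ‖y‖)) ^ p) := by
          rw [norm_smul]
          gcongr
          refine (hb _).trans ?_
          gcongr
          exact (one_add_norm_sub_smul_le z y h0 h1).trans (by gcongr)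
      _ = _ := by rw [mul_pow]; ring
  · have hd : HasFDerivAt F (fderiv ℝ F (z - ε • y)) (z - ε • y) :=
      (hF.1.differentiable (by simp) _).hasFDerivAt
    exact (hd.comp z ((hasFDerivAt_id z).sub_const (ε • y))).const_smul (ρ y)

end SchwartzMap

end Mollifier

section Moments

variable {n : ℕ} {V : Type} [NormedAddCommGroup V] [NormedSpace ℝ V] [CompleteSpace V]

namespace SchwartzMap

lemma integral_smul_multilinear_eq_zero (ρ : SchwartzMap (EuclideanSpace ℝ (Fin n)) ℝ)
    (hρ : ∀ α : Fin n → ℕ, α ≠ 0 →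
      ∫ x : EuclideanSpace ℝ (Fin n), (∏ i, x i ^ α i) * ρ x = 0)
    {j : ℕ} (hj : j ≠ 0)
    (M : ContinuousMultilinearMap ℝ (fun _ : Fin j => EuclideanSpace ℝ (Fin n)) V) :
    ∫ y, ρ y • (M fun _ => y) = 0 := by
  let b := EuclideanSpace.basisFun (Fin n) ℝ
  let α : (Fin j → Fin n) → Fin n → ℕ := fun r i => (Finset.univ.filter (r · = i)).card
  have hprod (r : Fin j → Fin n) (y : EuclideanSpace ℝ (Fin n)) :
      ∏ l, y (r l) = ∏ i, y i ^ α r i := by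
    rw [← Finset.prod_fiberwise' Finset.univ r (fun i => y i)]
    simp [α]
  have hexp (y : EuclideanSpace ℝ (Fin n)) :
      ρ y • (M fun _ => y) = ∑ r : Fin j → Fin n,
        ((∏ i, y i ^ α r i) * ρ y) • M fun l => b (r l) := by
    have hy : y = ∑ i, y i • b i := by simpa [b] using (b.sum_repr y).symm
    have hM : (M fun _ => y) = M fun _ => ∑ i, y i • b i := by rw [← hy]
    rw [hM, M.map_sum, Finset.smul_sum]
    refine Finset.sum_congr rfl fun r _ => ?_
    rw [M.map_smul_univ (fun l => y (r l)) (fun l => b (r l)), hprod, smul_smul, mul_comm]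
  have hα (r : Fin j → Fin n) : α r ≠ 0 := fun h => by
    have h' := congrFun h (r ⟨0, Nat.pos_of_ne_zero hj⟩)
    simp only [α, Pi.zero_apply, Finset.card_eq_zero] at h'
    exact Finset.filter_eq_empty_iff.mp h' (Finset.mem_univ ⟨0, Nat.pos_of_ne_zero hj⟩) rfl
  have hint (r : Fin j → Fin n) :
      Integrable fun y : EuclideanSpace ℝ (Fin n) => (∏ i, y i ^ α r i) * ρ y := by
    have h : Integrable fun y : EuclideanSpace ℝ (Fin n) => ρ y • ∏ l, y (r l) := by
      refine ρ.integrable_smul_of_norm_le (C := 1) (m := j) (by fun_prop) fun y => ?_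
      rw [norm_prod, one_mul]
      refine (Finset.prod_le_prod (g := fun _ => 1 + ‖y‖) (fun _ _ => norm_nonneg _)
        fun l _ => ?_).trans (by simp)
      linarith [PiLp.norm_apply_le y (r l)]
    simpa only [hprod, smul_eq_mul, mul_comm] using h
  simp_rw [hexp]
  rw [integral_finsetSum _ fun r _ => (hint r).smul_const _]
  refine Finset.sum_eq_zero fun r _ => ?_
  rw [integral_smul_const, hρ _ (hα r), zero_smul]

lemma exists_norm_mollify_sub_self_le
    (ρ : SchwartzMap (EuclideanSpace ℝ (Fin n)) ℝ) (hρ1 : ∫ x, ρ x = 1)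
    (hρ : ∀ α : Fin n → ℕ, α ≠ 0 →
      ∫ x : EuclideanSpace ℝ (Fin n), (∏ i, x i ^ α i) * ρ x = 0)
    {F : EuclideanSpace ℝ (Fin n) → V} (hF : F.HasTemperateGrowth) (q : ℕ) (R : ℝ) :
    ∃ C : ℝ, ∀ ε : ℝ, 0 ≤ ε → ε ≤ 1 → ∀ x, ‖x‖ ≤ R →
      ‖(∫ y, ρ y • F (x - ε • y)) - F x‖ ≤ C * ε ^ q := by
  obtain ⟨p, C, hC, hb⟩ := hF.norm_iteratedFDeriv_le_uniform (q + 1)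
  refine ⟨∫ y, C * (1 + R) ^ p * ((1 + ‖y‖) ^ (p + (q + 1)) * ‖ρ y‖),
    fun ε h0 h1 x hx => ?_⟩
  let T : EuclideanSpace ℝ (Fin n) → V := fun y => ∑ k ∈ Finset.range (q + 1),
    (k.factorial : ℝ)⁻¹ • iteratedFDeriv ℝ k F x (fun _ => -(ε • y))
  have hterm (k : ℕ) (y : EuclideanSpace ℝ (Fin n)) :
      ρ y • (k.factorial : ℝ)⁻¹ • iteratedFDeriv ℝ k F x (fun _ => -(ε • y))
        = ((k.factorial : ℝ)⁻¹ * (-ε) ^ k) • ρ y • iteratedFDeriv ℝ k F x (fun _ => y) := by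
    have h := (iteratedFDeriv ℝ k F x).map_smul_univ (fun _ => -ε) (fun _ => y)
    simp only [neg_smul, Finset.prod_const, Finset.card_univ, Fintype.card_fin] at h
    rw [h]
    module
  have hTint (k : ℕ) : Integrable fun y =>
      ρ y • (k.factorial : ℝ)⁻¹ • iteratedFDeriv ℝ k F x (fun _ => -(ε • y)) := by
    simp_rw [hterm]
    exact (ρ.integrable_smul_multilinear _).smul _
  have hT : ∫ y, ρ y • T y = F x := by
    simp only [T, Finset.smul_sum]
    rw [integral_finsetSum _ fun k _ => hTint k, Finset.sum_range_succ',
      Finset.sum_eq_zero fun k _ => ?_]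
    · simp [integral_smul_const, hρ1]
    · simp_rw [hterm]
      rw [integral_smul, ρ.integral_smul_multilinear_eq_zero hρ k.succ_ne_zero, smul_zero]
  have hTi : Integrable fun y => ρ y • T y := by
    simp only [T, Finset.smul_sum]
    exact integrable_finsetSum _ fun k _ => hTint k
  have hsub : (∫ y, ρ y • F (x - ε • y)) - F x = ∫ y, ρ y • (F (x - ε • y) - T y) := by
    simp_rw [smul_sub]
    rw [integral_sub (ρ.integrable_smul_comp_sub_smul hF h0 h1 x) hTi, hT]
  rw [hsub, ← integral_mul_const]
  refine norm_integral_le_of_norm_le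
    (((ρ.integrable_one_add_norm_pow_mul _).const_mul _).mul_const _) (.of_forall fun y => ?_)
  have hrem := norm_sub_taylor_sum_le hC
    (hF.1.of_le (by exact_mod_cast le_top)) (hb (q + 1) le_rfl) x (-(ε • y))
  rw [← sub_eq_add_neg, norm_neg, norm_smul, Real.norm_of_nonneg h0] at hrem
  have hR : 0 ≤ R := (norm_nonneg x).trans hx
  have hbase : 1 + ‖x‖ + ε * ‖y‖ ≤ (1 + R) * (1 + ‖y‖) := by
    nlinarith [norm_nonneg y, mul_nonneg hR (norm_nonneg y)]
  rw [norm_smul]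
  calc ‖ρ y‖ * ‖F (x - ε • y) - T y‖
      ≤ ‖ρ y‖ * (C * (1 + ‖x‖ + ε * ‖y‖) ^ p * (ε * ‖y‖) ^ (q + 1)) := by gcongr
    _ ≤ ‖ρ y‖ * (C * ((1 + R) * (1 + ‖y‖)) ^ p * (ε ^ q * (1 + ‖y‖) ^ (q + 1))) := by
        rw [mul_pow ε]
        gcongr ‖ρ y‖ * (C * ?_ ^ p * (?_ * ?_ ^ (q + 1)))
        · exact pow_le_pow_of_le_one h0 h1 q.le_succ
        · linarith
    _ = _ := by rw [mul_pow]; ring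

lemma exists_norm_iteratedFDeriv_mollify_sub_self_le
    (ρ : SchwartzMap (EuclideanSpace ℝ (Fin n)) ℝ) (hρ1 : ∫ x, ρ x = 1)
    (hρ : ∀ α : Fin n → ℕ, α ≠ 0 →
      ∫ x : EuclideanSpace ℝ (Fin n), (∏ i, x i ^ α i) * ρ x = 0)
    (k q : ℕ) (R : ℝ) {V : Type} [NormedAddCommGroup V] [NormedSpace ℝ V] [CompleteSpace V]
    {F : EuclideanSpace ℝ (Fin n) → V} (hF : F.HasTemperateGrowth) :
    ∃ C : ℝ, ∀ ε : ℝ, 0 ≤ ε → ε ≤ 1 → ∀ x, ‖x‖ ≤ R →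
      ‖iteratedFDeriv ℝ k (fun z => (∫ y, ρ y • F (z - ε • y)) - F z) x‖ ≤ C * ε ^ q := by
  induction k generalizing V with
  | zero => simpa using ρ.exists_norm_mollify_sub_self_le hρ1 hρ hF q R
  | succ k ih =>
    obtain ⟨C, h⟩ := ih hF.fderiv
    refine ⟨C, fun ε h0 h1 x hx => ?_⟩
    have hfd : fderiv ℝ (fun z => (∫ y, ρ y • F (z - ε • y)) - F z)
        = fun z => (∫ y, ρ y • fderiv ℝ F (z - ε • y)) - fderiv ℝ F z := by
      ext1 z
      exact ((ρ.hasFDerivAt_integral_smul_comp_sub_smul hF h0 h1 z).sub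
        (hF.1.differentiable (by simp) z).hasFDerivAt).fderiv
    rw [← norm_iteratedFDeriv_fderiv, hfd]
    exact h ε h0 h1 x hx

lemma integral_comp_sub_mul_rescale (ρ : SchwartzMap (EuclideanSpace ℝ (Fin n)) ℝ)
    (f : EuclideanSpace ℝ (Fin n) → ℝ) {ε : ℝ} (hε : 0 < ε) (z : EuclideanSpace ℝ (Fin n)) :
    ∫ y, f (z - y) * ((ε ^ n)⁻¹ * ρ (ε⁻¹ • y)) = ∫ y, ρ y • f (z - ε • y) := by
  have h := Measure.integral_comp_inv_smul_of_nonneg volume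
    (fun y => ρ y * f (z - ε • y)) hε.le
  simp only [smul_inv_smul₀ hε.ne', finrank_euclideanSpace_fin, smul_eq_mul] at h
  simp only [smul_eq_mul]
  rw [← inv_mul_cancel_left₀ (pow_pos hε n).ne' (∫ y, ρ y * f (z - ε • y)), ← h,
    ← integral_const_mul]
  congr 1 with y
  ring

end SchwartzMap

end Moments

/-- **Consistency of the Colombeau embedding on slowly increasing smooth functions.**
Let `ρ` be a Schwartz function on `ℝⁿ` with `∫ρ = 1` and all higher moments vanishing, and
`ρ_ε(x) = ε^{-n} ρ(x/ε)`.  If `f` is smooth with all derivatives polynomially bounded, then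
the family `(f ∗ ρ_ε - f)` is negligible: on every compact set, every derivative decays
faster than any power of `ε` as `ε → 0⁺`. -/
theorem convolution_mollifier_sub_self_negligible {n : ℕ}
    (ρ : SchwartzMap (EuclideanSpace ℝ (Fin n)) ℝ)
    (hρ1 : ∫ x : EuclideanSpace ℝ (Fin n), ρ x = 1)
    (hρmom : ∀ α : Fin n → ℕ, α ≠ 0 →
      ∫ x : EuclideanSpace ℝ (Fin n), (∏ i, x i ^ α i) * ρ x = 0)
    (f : EuclideanSpace ℝ (Fin n) → ℝ) (hf : ContDiff ℝ (⊤ : ℕ∞) f)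
    (hfpoly : ∀ k : ℕ, ∃ C > (0:ℝ), ∃ p : ℕ, ∀ x,
      ‖iteratedFDeriv ℝ k f x‖ ≤ C * (1 + ‖x‖) ^ p) :
    ∀ K : Set (EuclideanSpace ℝ (Fin n)), IsCompact K → ∀ k q : ℕ,
      ∃ C : ℝ, ∀ᶠ ε in 𝓝[>] (0:ℝ), ∀ x ∈ K,
        ‖iteratedFDeriv ℝ k
          (fun z => (∫ y : EuclideanSpace ℝ (Fin n),
              f (z - y) * ((ε ^ n)⁻¹ * ρ (ε⁻¹ • y))) - f z) x‖ ≤ C * ε ^ q := by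
  intro K hK k q
  have hF : f.HasTemperateGrowth := ⟨hf, fun k => by
    obtain ⟨C, -, p, h⟩ := hfpoly k
    exact ⟨p, C, h⟩⟩
  obtain ⟨R, hR⟩ := hK.isBounded.exists_norm_le
  obtain ⟨C, hC⟩ := ρ.exists_norm_iteratedFDeriv_mollify_sub_self_le hρ1 hρmom k q R hF
  refine ⟨C, ?_⟩
  filter_upwards [Ioc_mem_nhdsGT (zero_lt_one' ℝ)] with ε hε x hx
  simp_rw [ρ.integral_comp_sub_mul_rescale f hε.1]
  exact hC ε hε.1.le hε.2 x (hR x hx)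
end
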